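/- For every k ≥ 5 there exists a cyclically 4-edge-connected cubic graph on 2k+... vertices (the graph L_{2k}) with list normal chromatic index at least 7; hence there are infinitely many cyclically 4-edge-connected cubic graphs with list normal chromatic index at least 7. -/

import Mathlib

open SimpleGraph

/-- Two edges (as elements of `Sym2 V`) are adjacent: distinct and sharing an endvertex. -/
def EdgeAdj {V : Type*} (e f : Sym2 V) : Prop := e ≠ f ∧ ∃ v, v ∈ e ∧ v ∈ f

/-- Two edges are at distance at most 2 in `G`: adjacent, or both adjacent to a common edge. -/
def DistLE2 {V : Type*} (G : SimpleGraph V) (e f : Sym2 V) : Prop :=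
  EdgeAdj e f ∨ ∃ g ∈ G.edgeSet, EdgeAdj e g ∧ EdgeAdj g f

/-- A strong edge-coloring: any two distinct edges at distance at most 2 get distinct colors. -/
def IsStrongEdgeColoring {V : Type*} (G : SimpleGraph V) {C : Type*} (φ : Sym2 V → C) : Prop :=
  ∀ e ∈ G.edgeSet, ∀ f ∈ G.edgeSet, DistLE2 G e f → φ e ≠ φ f

/-- A proper edge-coloring: adjacent edges get distinct colors. -/
def IsProperEdgeColoring {V : Type*} (G : SimpleGraph V) {C : Type*} (φ : Sym2 V → C) : Prop :=
  ∀ e ∈ G.edgeSet, ∀ f ∈ G.edgeSet, EdgeAdj e f → φ e ≠ φ f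

/-- An edge is rich: its adjacent edges carry 4 distinct colors. -/
def IsRich {V : Type*} (G : SimpleGraph V) {C : Type*} (φ : Sym2 V → C) (e : Sym2 V) : Prop :=
  (φ '' {f | f ∈ G.edgeSet ∧ EdgeAdj e f}).ncard = 4

/-- An edge is poor: its adjacent edges carry exactly 2 distinct colors. -/
def IsPoor {V : Type*} (G : SimpleGraph V) {C : Type*} (φ : Sym2 V → C) (e : Sym2 V) : Prop :=
  (φ '' {f | f ∈ G.edgeSet ∧ EdgeAdj e f}).ncard = 2

/-- A normal edge-coloring: proper, and every edge is rich or poor. -/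
def IsNormalEdgeColoring {V : Type*} (G : SimpleGraph V) {C : Type*} (φ : Sym2 V → C) : Prop :=
  IsProperEdgeColoring G φ ∧ ∀ e ∈ G.edgeSet, IsRich G φ e ∨ IsPoor G φ e

/-- A graph is cyclically 4-edge-connected: every edge-cut separating two parts each
containing a cycle has at least 4 edges. -/
def CyclicallyFourEdgeConnected {V : Type*} (G : SimpleGraph V) : Prop :=
  ∀ S : Set V,
    (∃ v : V, ∃ w : G.Walk v v, w.IsCycle ∧ ∀ u ∈ w.support, u ∈ S) →
    (∃ v : V, ∃ w : G.Walk v v, w.IsCycle ∧ ∀ u ∈ w.support, u ∉ S) →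
    4 ≤ {e : Sym2 V | e ∈ G.edgeSet ∧ ∃ a b, e = s(a, b) ∧ a ∈ S ∧ b ∉ S}.ncard


theorem LN.key {V : Type} (G : SimpleGraph V) (φ : Sym2 V → ℕ) (h : IsNormalEdgeColoring G φ)
    (x y p q r s : V) (hx : ∀ z, G.Adj x z ↔ z = y ∨ z = p ∨ z = q)
    (hy : ∀ z, G.Adj y z ↔ z = x ∨ z = r ∨ z = s)
    (hyp : y ≠ p) (hyq : y ≠ q) (hpq : p ≠ q) (hxr : x ≠ r) (hxs : x ≠ s) (hrs : r ≠ s) :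
    φ s(x, y) ≠ φ s(x, p) ∧ φ s(x, y) ≠ φ s(x, q) ∧ φ s(x, p) ≠ φ s(x, q) ∧
    φ s(x, y) ≠ φ s(y, r) ∧ φ s(x, y) ≠ φ s(y, s) ∧ φ s(y, r) ≠ φ s(y, s) ∧
    ((φ s(x, p) ≠ φ s(y, r) ∧ φ s(x, p) ≠ φ s(y, s) ∧ φ s(x, q) ≠ φ s(y, r) ∧
      φ s(x, q) ≠ φ s(y, s)) ∨ (φ s(x, p) = φ s(y, r) ∧ φ s(x, q) = φ s(y, s)) ∨
      (φ s(x, p) = φ s(y, s) ∧ φ s(x, q) = φ s(y, r))) := by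
  have axy : G.Adj x y := (hx y).2 (by simp)
  have axp : G.Adj x p := (hx p).2 (by simp)
  have axq : G.Adj x q := (hx q).2 (by simp)
  have ayr : G.Adj y r := (hy r).2 (by simp)
  have ays : G.Adj y s := (hy s).2 (by simp)
  have prop : ∀ v a b, G.Adj v a → G.Adj v b → a ≠ b → φ s(v, a) ≠ φ s(v, b) := by
    intro v a b ha hb hab
    refine h.1 _ ha _ hb ⟨?_, v, by simp, by simp⟩
    intro he
    exact hab (Sym2.congr_right.1 he)
  have h1 := prop x y p axy axp hyp
  have h2 := prop x y q axy axq hyq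
  have h3 := prop x p q axp axq hpq
  have h4 := prop y x r axy.symm ayr hxr
  have h5 := prop y x s axy.symm ays hxs
  have h6 := prop y r s ayr ays hrs
  rw [Sym2.eq_swap] at h4 h5
  refine ⟨h1, h2, h3, h4, h5, h6, ?_⟩
  have hset : {f | f ∈ G.edgeSet ∧ EdgeAdj s(x, y) f} = {s(x, p), s(x, q), s(y, r), s(y, s)} := by
    ext f
    simp only [Set.mem_ofPred_eq, Set.mem_insert_iff, Set.mem_singleton_iff, EdgeAdj]
    constructor
    · rintro ⟨hf, hne, v, hv, hvf⟩
      obtain ⟨z, rfl⟩ := Sym2.mem_iff_exists.1 hvf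
      rw [SimpleGraph.mem_edgeSet] at hf
      rcases Sym2.mem_iff.1 hv with rfl | rfl
      · rcases (hx z).1 hf with rfl | rfl | rfl
        · exact absurd rfl hne
        · simp
        · simp
      · rcases (hy z).1 hf with rfl | rfl | rfl
        · exact absurd Sym2.eq_swap hne
        · simp
        · simp
    · have hx1 : ∀ z, y ≠ z → s(x, y) ≠ s(x, z) := fun z hz he => hz (Sym2.congr_right.1 he)
      have hy1 : ∀ z, x ≠ z → s(x, y) ≠ s(y, z) := fun z hz he => by
        rw [Sym2.eq_swap] at he
        exact hz (Sym2.congr_right.1 he)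
      rintro (rfl | rfl | rfl | rfl)
      · exact ⟨axp, hx1 _ hyp, x, by simp, by simp⟩
      · exact ⟨axq, hx1 _ hyq, x, by simp, by simp⟩
      · exact ⟨ayr, hy1 _ hxr, y, by simp, by simp⟩
      · exact ⟨ays, hy1 _ hxs, y, by simp, by simp⟩
  have himg : φ '' {f | f ∈ G.edgeSet ∧ EdgeAdj s(x, y) f} =
      (({φ s(x, p), φ s(x, q), φ s(y, r), φ s(y, s)} : Finset ℕ) : Set ℕ) := by
    rw [hset]; simp [Set.image_insert_eq]
  have := h.2 s(x, y) axy
  unfold IsRich IsPoor at this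
  rw [himg, Set.ncard_coe_finset] at this
  generalize φ s(x, p) = a at *
  generalize φ s(x, q) = b at *
  generalize φ s(y, r) = c at *
  generalize φ s(y, s) = d at *
  by_cases e1 : a = c <;> by_cases e2 : a = d <;> by_cases e3 : b = c <;> by_cases e4 : b = d <;>
    simp_all [Finset.card_insert_of_notMem]

theorem LN.arith (p q r a1 a2 a3 b0 b1 b2 b3 c2 d e : ℕ)
    (ha2 : a2 < 6) (ha3 : a3 < 6) (hb1 : b1 < 6) (hb2 : b2 < 6) (hb3 : b3 < 6) (ha1 : a1 < 6)
    (hb0 : b0 < 6)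
    (hd : d < 6) (he : e < 6) (hc2 : c2 < 6) (hp : 6 ≤ p) (hq : 6 ≤ q) (hr : 6 ≤ r)
    (C1 : (p ≠ b0 ∧ p ≠ b1 ∧ a1 ≠ b0 ∧ a1 ≠ b1) ∨ (p = b0 ∧ a1 = b1) ∨ (p = b1 ∧ a1 = b0))
    (A3 : (a2 ≠ q ∧ a2 ≠ e ∧ d ≠ q ∧ d ≠ e) ∨ (a2 = q ∧ d = e) ∨ (a2 = e ∧ d = q))
    (E : (a3 ≠ b2 ∧ a3 ≠ b3 ∧ q ≠ b2 ∧ q ≠ b3) ∨ (a3 = b2 ∧ q = b3) ∨ (a3 = b3 ∧ q = b2))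
    (B3 : (b2 ≠ r ∧ b2 ≠ d ∧ e ≠ r ∧ e ≠ d) ∨ (b2 = r ∧ e = d) ∨ (b2 = d ∧ e = r))
    (D : (a2 ≠ b3 ∧ a2 ≠ r ∧ a3 ≠ b3 ∧ a3 ≠ r) ∨ (a2 = b3 ∧ a3 = r) ∨ (a2 = r ∧ a3 = b3))
    (B2 : (b1 ≠ b3 ∧ b1 ≠ e ∧ c2 ≠ b3 ∧ c2 ≠ e) ∨ (b1 = b3 ∧ c2 = e) ∨ (b1 = e ∧ c2 = b3))
    (C2 : (a1 ≠ b1 ∧ a1 ≠ b2 ∧ a2 ≠ b1 ∧ a2 ≠ b2) ∨ (a1 = b1 ∧ a2 = b2) ∨ (a1 = b2 ∧ a2 = b1))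
    (A2 : (a1 ≠ a3 ∧ a1 ≠ d ∧ c2 ≠ a3 ∧ c2 ≠ d) ∨ (a1 = a3 ∧ c2 = d) ∨ (a1 = d ∧ c2 = a3))
    (h1 : a3 ≠ e) (h2 : a3 ≠ d) (h3 : b3 ≠ e) (h4 : b3 ≠ d) (h5 : a2 ≠ a3) (h6 : a2 ≠ d)
    (h7 : b2 ≠ e) (h8 : b2 ≠ b3) (h9 : c2 ≠ a2) (h10 : c2 ≠ b2) (h11 : b1 ≠ c2)
    (h12 : b1 ≠ b2) (h13 : a1 ≠ c2) (h14 : a1 ≠ a2) : False := by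
  have C1' : a1 ≠ b1 := by clear * - hp hb0 hb1 C1; omega
  have A3' : a2 ≠ e ∧ d ≠ e := by clear * - hq ha2 hd A3; omega
  have E' : a3 ≠ b2 ∧ a3 ≠ b3 := by clear * - hq hb2 hb3 E; omega
  have B3' : b2 ≠ d := by clear * - hr hb2 he B3; omega
  have D' : a2 ≠ b3 := by clear * - hr ha2 ha3 D; omega
  clear C1 A3 E B3 D
  have pig : ∀ x, x < 6 → a2 ≠ b2 → x = a2 ∨ x = b2 ∨ x = a3 ∨ x = b3 ∨ x = d ∨ x = e := by
    intro x hx hab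
    clear B2 C2 A2
    by_contra hcon
    push Not at hcon
    have hsub : ({x, a2, b2, a3, b3, d, e} : Finset ℕ) ⊆ Finset.range 6 := by
      intro z hz
      simp only [Finset.mem_insert, Finset.mem_singleton] at hz
      rw [Finset.mem_range]
      rcases hz with rfl | rfl | rfl | rfl | rfl | rfl | rfl <;> assumption
    have := Finset.card_le_card hsub
    rw [Finset.card_range] at this
    have h7 : ({x, a2, b2, a3, b3, d, e} : Finset ℕ).card = 7 := by
      repeat rw [Finset.card_insert_of_notMem
        (by simp only [Finset.mem_insert, Finset.mem_singleton]; grind)]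
      simp
    omega
  have hab : a2 ≠ b2 := by clear * - C1' C2; grind
  have k1 := pig c2 hc2 hab
  have k2 := pig a1 ha1 hab
  have k3 := pig b1 hb1 hab
  clear pig
  grind

theorem LN.four {α : Type} [Finite α] (T : Set α) (e1 e2 e3 e4 : α)
    (h1 : e1 ∈ T) (h2 : e2 ∈ T) (h3 : e3 ∈ T) (h4 : e4 ∈ T) (h12 : e1 ≠ e2) (h13 : e1 ≠ e3)
    (h14 : e1 ≠ e4) (h23 : e2 ≠ e3) (h24 : e2 ≠ e4) (h34 : e3 ≠ e4) : 4 ≤ T.ncard := by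
  classical
  have hs : (({e1, e2, e3, e4} : Finset α) : Set α) ⊆ T := by
    intro z hz
    simp at hz
    rcases hz with rfl | rfl | rfl | rfl <;> assumption
  have := Set.ncard_le_ncard hs (Set.toFinite T)
  rw [Set.ncard_coe_finset] at this
  simpa [h12, h13, h14, h23, h24, h34] using this

abbrev LN.V (n : ℕ) : Type := Bool × ZMod (n + 6)

def LN.G (n : ℕ) : SimpleGraph (LN.V n) where
  Adj x y := (x.1 = y.1 ∧ (y.2 = x.2 + 1 ∨ x.2 = y.2 + 1)) ∨
    (y.1 = !x.1 ∧ y.2 = Equiv.swap (3 : ZMod (n + 6)) 4 x.2)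
  symm := ⟨by
    rintro ⟨b, i⟩ ⟨c, j⟩ (⟨h1, h2⟩ | ⟨h1, h2⟩)
    · exact Or.inl ⟨h1.symm, h2.symm⟩
    · right
      simp only at h1 h2
      subst h1 h2
      simp⟩
  loopless := ⟨by
    rintro ⟨b, i⟩ (⟨h1, h2⟩ | ⟨h1, h2⟩)
    · simp only at h2
      have : Fact (1 < n + 6) := ⟨by omega⟩
      rcases h2 with h2 | h2 <;> simp at h2
    · simp at h1⟩

theorem LN.ne (n : ℕ) (a b : ℕ) (ha : a < 6) (hb : b < 6) (hab : a ≠ b) :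
    ((a : ℕ) : ZMod (n + 6)) ≠ (b : ℕ) := by
  intro h
  rw [ZMod.natCast_eq_natCast_iff', Nat.mod_eq_of_lt (by omega), Nat.mod_eq_of_lt (by omega)] at h
  exact hab h

theorem LN.adj (n : ℕ) (b : Bool) (i : ZMod (n + 6)) (z : LN.V n) : (LN.G n).Adj (b, i) z ↔
    z = (b, i + 1) ∨ z = (b, i - 1) ∨ z = (!b, Equiv.swap (3 : ZMod (n + 6)) 4 i) := by
  obtain ⟨c, j⟩ := z
  simp only [LN.G, Prod.mk.injEq]
  constructor
  · rintro (⟨h1, h2 | h2⟩ | ⟨h1, h2⟩)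
    · exact Or.inl ⟨h1.symm, h2⟩
    · exact Or.inr (Or.inl ⟨h1.symm, by rw [h2]; ring⟩)
    · exact Or.inr (Or.inr ⟨h1, h2⟩)
  · rintro (⟨h1, h2⟩ | ⟨h1, h2⟩ | ⟨h1, h2⟩)
    · exact Or.inl ⟨h1.symm, Or.inl h2⟩
    · exact Or.inl ⟨h1.symm, Or.inr (by rw [h2]; ring)⟩
    · exact Or.inr ⟨h1, h2⟩

theorem LN.two (n : ℕ) : (2 : ZMod (n + 6)) ≠ 0 := by
  simpa using LN.ne n 2 0 (by omega) (by omega) (by omega)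

theorem LN.pm (n : ℕ) (i : ZMod (n + 6)) : i + 1 ≠ i - 1 := by
  intro h
  apply LN.two n
  linear_combination h

theorem LN.cubic (n : ℕ) (v : LN.V n) : ((LN.G n).neighborSet v).ncard = 3 := by
  obtain ⟨b, i⟩ := v
  have : (LN.G n).neighborSet (b, i) =
      (({(b, i + 1), (b, i - 1), (!b, Equiv.swap (3 : ZMod (n + 6)) 4 i)} : Finset (LN.V n)) :
        Set (LN.V n)) := by
    ext z
    simp [LN.adj]
  rw [this, Set.ncard_coe_finset]
  have := LN.pm n i
  rw [Finset.card_insert_of_notMem, Finset.card_insert_of_notMem, Finset.card_singleton]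
  · simp
  · simpa using this

theorem LN.ind (n : ℕ) (P : ZMod (n + 6) → Prop) (i0 : ZMod (n + 6)) (h0 : P i0)
    (hs : ∀ i, P i → P (i + 1)) (j : ZMod (n + 6)) : P j := by
  have : ∀ m : ℕ, P (i0 + m) := by
    intro m
    induction m with
    | zero => simpa using h0
    | succ m ih => simpa [add_assoc] using hs _ ih
  have h := this (j - i0).val
  rw [ZMod.natCast_zmod_val] at h
  simpa using h

theorem LN.one_row (n : ℕ) (S : Set (LN.V n)) (b : Bool) (hb : ∀ i, (b, i) ∈ S)
    (hc : ∃ v, ∃ w : (LN.G n).Walk v v, w.IsCycle ∧ ∀ u ∈ w.support, u ∉ S) :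
    4 ≤ {e : Sym2 (LN.V n) | e ∈ (LN.G n).edgeSet ∧
      ∃ a b, e = s(a, b) ∧ a ∈ S ∧ b ∉ S}.ncard := by
  obtain ⟨v, w, hw, hS⟩ := hc
  have hrow : ∀ u ∈ w.support, u.1 = !b := by
    rintro ⟨c, i⟩ hu
    by_contra hne
    have : c = b := by
      cases c <;> cases b <;> simp_all
    subst this
    exact hS _ hu (hb i)
  have hstep : ∀ i, (!b, i) ∈ w.support → (!b, i + 1) ∈ w.support := by
    intro i hi
    have h2 := hw.ncard_neighborSet_toSubgraph_eq_two hi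
    have hsub : w.toSubgraph.neighborSet (!b, i) ⊆
        (({(!b, i + 1), (!b, i - 1)} : Finset (LN.V n)) : Set (LN.V n)) := by
      intro z hz
      have hz' : w.toSubgraph.Adj (!b, i) z := hz
      have hzs : z ∈ w.support := by
        have := hz'.snd_mem
        simpa using this
      have hr := hrow z hzs
      rcases (LN.adj n _ _ _).1 hz'.adj_sub with h | h | h
      · simp [h]
      · simp [h]
      · rw [h] at hr
        simp at hr
    have heq := Set.eq_of_subset_of_ncard_le hsub (by
      rw [h2, Set.ncard_coe_finset]
      exact Finset.card_le_two)
    have hm : (!b, i + 1) ∈ w.toSubgraph.neighborSet (!b, i) := by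
      rw [heq]; simp
    have hm' : w.toSubgraph.Adj (!b, i) (!b, i + 1) := hm
    simpa using hm'.snd_mem
  have hall : ∀ j, (!b, j) ∈ w.support := by
    have hv : v ∈ w.support := w.start_mem_support
    have h1 := hrow v hv
    refine LN.ind n (fun j => (!b, j) ∈ w.support) v.2 ?_ hstep
    rw [← h1]
    exact hv
  have hmem : ∀ i, s((b, i), (!b, Equiv.swap (3 : ZMod (n + 6)) 4 i)) ∈
      {e : Sym2 (LN.V n) | e ∈ (LN.G n).edgeSet ∧ ∃ a b, e = s(a, b) ∧ a ∈ S ∧ b ∉ S} := by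
    intro i
    refine ⟨?_, _, _, rfl, hb i, hS _ (hall _)⟩
    rw [SimpleGraph.mem_edgeSet, LN.adj]
    simp
  have hinj : ∀ i j : ZMod (n + 6), i ≠ j →
      s(((b, i) : LN.V n), (!b, Equiv.swap (3 : ZMod (n + 6)) 4 i)) ≠
        s((b, j), (!b, Equiv.swap (3 : ZMod (n + 6)) 4 j)) := by
    intro i j hij h
    rw [Sym2.eq_iff] at h
    rcases h with h | h <;> simp at h
    exact hij h
  have := fun a b ha hb hab => LN.ne n a b ha hb hab
  exact LN.four _ _ _ _ _ (hmem (0 : ℕ)) (hmem (1 : ℕ)) (hmem (2 : ℕ)) (hmem (3 : ℕ))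
    (hinj _ _ (LN.ne n _ _ (by omega) (by omega) (by omega)))
    (hinj _ _ (LN.ne n _ _ (by omega) (by omega) (by omega)))
    (hinj _ _ (LN.ne n _ _ (by omega) (by omega) (by omega)))
    (hinj _ _ (LN.ne n _ _ (by omega) (by omega) (by omega)))
    (hinj _ _ (LN.ne n _ _ (by omega) (by omega) (by omega)))
    (hinj _ _ (LN.ne n _ _ (by omega) (by omega) (by omega)))

theorem LN.cut_compl (n : ℕ) (S : Set (LN.V n)) :
    {e : Sym2 (LN.V n) | e ∈ (LN.G n).edgeSet ∧ ∃ a b, e = s(a, b) ∧ a ∈ Sᶜ ∧ b ∉ Sᶜ} =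
    {e : Sym2 (LN.V n) | e ∈ (LN.G n).edgeSet ∧ ∃ a b, e = s(a, b) ∧ a ∈ S ∧ b ∉ S} := by
  ext e
  constructor
  · rintro ⟨h, a, b, rfl, ha, hb⟩
    exact ⟨h, b, a, Sym2.eq_swap, by simpa using hb, ha⟩
  · rintro ⟨h, a, b, rfl, ha, hb⟩
    exact ⟨h, b, a, Sym2.eq_swap, hb, by simpa using ha⟩

theorem LN.mixed (n : ℕ) (S : Set (LN.V n)) (b : Bool) (h1 : ∃ i, (b, i) ∈ S)
    (h2 : ∃ i, (b, i) ∉ S) : ∃ i j : ZMod (n + 6), i ≠ j ∧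
      ((b, i) ∈ S ∧ (b, i + 1) ∉ S) ∧ ((b, j) ∉ S ∧ (b, j + 1) ∈ S) := by
  obtain ⟨i1, h1⟩ := h1
  obtain ⟨i2, h2⟩ := h2
  have A : ∃ i, (b, i) ∈ S ∧ (b, i + 1) ∉ S := by
    by_contra hcon
    push Not at hcon
    exact h2 (LN.ind n (fun i => (b, i) ∈ S) i1 h1 hcon i2)
  have B : ∃ i, (b, i) ∉ S ∧ (b, i + 1) ∈ S := by
    by_contra hcon
    push Not at hcon
    exact LN.ind n (fun i => (b, i) ∉ S) i2 h2 hcon i1 h1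
  obtain ⟨i, hi⟩ := A
  obtain ⟨j, hj⟩ := B
  refine ⟨i, j, ?_, hi, hj⟩
  rintro rfl
  exact hj.1 hi.1

theorem LN.rail_ne (n : ℕ) (b c : Bool) (i j : ZMod (n + 6)) (h : b ≠ c ∨ i ≠ j) :
    s(((b, i) : LN.V n), (b, i + 1)) ≠ s((c, j), (c, j + 1)) := by
  intro he
  rw [Sym2.eq_iff] at he
  simp only [Prod.mk.injEq] at he
  rcases he with ⟨⟨h1, h2⟩, -⟩ | ⟨⟨h1, h2⟩, -, h3⟩
  · tauto
  · apply LN.two n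
    linear_combination h3 - h2

theorem LN.cyc (n : ℕ) : CyclicallyFourEdgeConnected (LN.G n) := by
  intro S hS hT
  by_cases hmix : ∀ b, (∃ i, (b, i) ∈ S) ∧ (∃ i, (b, i) ∉ S)
  · have hr : ∀ (b : Bool) (i : ZMod (n + 6)), s((b, i), (b, i + 1)) ∈ (LN.G n).edgeSet := by
      intro b i
      rw [SimpleGraph.mem_edgeSet, LN.adj]
      simp
    obtain ⟨i, j, hij, hi, hj⟩ := LN.mixed n S true (hmix true).1 (hmix true).2
    obtain ⟨k, l, hkl, hk, hl⟩ := LN.mixed n S false (hmix false).1 (hmix false).2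
    exact LN.four _ s((true, i), (true, i + 1)) s((true, j), (true, j + 1))
      s((false, k), (false, k + 1)) s((false, l), (false, l + 1))
      ⟨hr _ _, _, _, rfl, hi.1, hi.2⟩ ⟨hr _ _, _, _, Sym2.eq_swap, hj.2, hj.1⟩
      ⟨hr _ _, _, _, rfl, hk.1, hk.2⟩ ⟨hr _ _, _, _, Sym2.eq_swap, hl.2, hl.1⟩
      (LN.rail_ne n _ _ _ _ (Or.inr hij)) (LN.rail_ne n _ _ _ _ (Or.inl (by simp)))
      (LN.rail_ne n _ _ _ _ (Or.inl (by simp))) (LN.rail_ne n _ _ _ _ (Or.inl (by simp)))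
      (LN.rail_ne n _ _ _ _ (Or.inl (by simp))) (LN.rail_ne n _ _ _ _ (Or.inr hkl))
  · push Not at hmix
    obtain ⟨b, hb⟩ := hmix
    by_cases hall : ∀ i, (b, i) ∈ S
    · exact LN.one_row n S b hall hT
    · have hnone : ∀ i, (b, i) ∈ Sᶜ := by
        intro i hi
        exact hall (hb ⟨i, hi⟩)
      rw [← LN.cut_compl]
      refine LN.one_row n Sᶜ b hnone ?_
      simpa using hS

open Classical in
noncomputable def LN.L (n : ℕ) (e : Sym2 (LN.V n)) : Finset ℕ :=
  if e = s((true, 0), (true, 1)) ∨ e = s((true, 4), (true, 5)) ∨ e = s((false, 4), (false, 5))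
  then Finset.Ico 6 12 else Finset.range 6

set_option maxHeartbeats 1000000 in
theorem LN.nocol (n : ℕ) : ¬ ∃ φ : Sym2 (LN.V n) → ℕ, IsNormalEdgeColoring (LN.G n) φ ∧
    ∀ e ∈ (LN.G n).edgeSet, φ e ∈ LN.L n e := by
  rintro ⟨φ, hφ, hL⟩
  have n01 : (0 : ZMod (n + 6)) ≠ 1 := by
    simpa using LN.ne n 0 1 (by omega) (by omega) (by omega)
  have n02 : (0 : ZMod (n + 6)) ≠ 2 := by simpa using LN.ne n 0 2 (by omega) (by omega) (by omega)
  have n03 : (0 : ZMod (n + 6)) ≠ 3 := by simpa using LN.ne n 0 3 (by omega) (by omega) (by omega)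
  have n04 : (0 : ZMod (n + 6)) ≠ 4 := by simpa using LN.ne n 0 4 (by omega) (by omega) (by omega)
  have n05 : (0 : ZMod (n + 6)) ≠ 5 := by simpa using LN.ne n 0 5 (by omega) (by omega) (by omega)
  have n12 : (1 : ZMod (n + 6)) ≠ 2 := by simpa using LN.ne n 1 2 (by omega) (by omega) (by omega)
  have n13 : (1 : ZMod (n + 6)) ≠ 3 := by simpa using LN.ne n 1 3 (by omega) (by omega) (by omega)
  have n14 : (1 : ZMod (n + 6)) ≠ 4 := by simpa using LN.ne n 1 4 (by omega) (by omega) (by omega)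
  have n15 : (1 : ZMod (n + 6)) ≠ 5 := by simpa using LN.ne n 1 5 (by omega) (by omega) (by omega)
  have n23 : (2 : ZMod (n + 6)) ≠ 3 := by simpa using LN.ne n 2 3 (by omega) (by omega) (by omega)
  have n24 : (2 : ZMod (n + 6)) ≠ 4 := by simpa using LN.ne n 2 4 (by omega) (by omega) (by omega)
  have n25 : (2 : ZMod (n + 6)) ≠ 5 := by simpa using LN.ne n 2 5 (by omega) (by omega) (by omega)
  have n34 : (3 : ZMod (n + 6)) ≠ 4 := by simpa using LN.ne n 3 4 (by omega) (by omega) (by omega)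
  have n35 : (3 : ZMod (n + 6)) ≠ 5 := by simpa using LN.ne n 3 5 (by omega) (by omega) (by omega)
  have n45 : (4 : ZMod (n + 6)) ≠ 5 := by simpa using LN.ne n 4 5 (by omega) (by omega) (by omega)
  have A1 : ∀ b z, (LN.G n).Adj (b, 1) z ↔ z = (b, 2) ∨ z = (b, 0) ∨ z = (!b, 1) := by
    intro b z
    rw [LN.adj, Equiv.swap_apply_of_ne_of_ne n13 n14]; norm_num
  have A2 : ∀ b z, (LN.G n).Adj (b, 2) z ↔ z = (b, 3) ∨ z = (b, 1) ∨ z = (!b, 2) := by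
    intro b z
    rw [LN.adj, Equiv.swap_apply_of_ne_of_ne n23 n24]; norm_num
  have A3 : ∀ b z, (LN.G n).Adj (b, 3) z ↔ z = (b, 4) ∨ z = (b, 2) ∨ z = (!b, 4) := by
    intro b z
    rw [LN.adj, Equiv.swap_apply_left]; norm_num
  have A4 : ∀ b z, (LN.G n).Adj (b, 4) z ↔ z = (b, 5) ∨ z = (b, 3) ∨ z = (!b, 3) := by
    intro b z
    rw [LN.adj, Equiv.swap_apply_right]; norm_num
  have kC1 := LN.key _ φ hφ (true, 1) (false, 1) (true, 0) (true, 2) (false, 0) (false, 2)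
    (by intro z; rw [A1]; simp only [Bool.not_true, Bool.not_false, or_assoc, or_comm, or_left_comm] <;>
      simp only [or_assoc]) (by intro z; rw [A1]; simp only [Bool.not_true, Bool.not_false, or_comm, or_left_comm] <;>
      simp only [or_assoc])
    (by simp) (by simp) (by simp [n02]) (by simp) (by simp) (by simp [n02])
  have kA3 := LN.key _ φ hφ (true, 3) (true, 4) (true, 2) (false, 4) (true, 5) (false, 3)
    (by intro z; rw [A3]; simp) (by intro z; rw [A4]; simp only [Bool.not_true, Bool.not_false, or_assoc, or_comm, or_left_comm] <;>
      simp only [or_assoc])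
    (by simp [n24.symm]) (by simp) (by simp) (by simp [n35]) (by simp) (by simp)
  have kE := LN.key _ φ hφ (true, 4) (false, 3) (true, 3) (true, 5) (false, 2) (false, 4)
    (by intro z; rw [A4]; simp only [Bool.not_true, Bool.not_false, or_assoc, or_comm, or_left_comm] <;>
      simp only [or_assoc]) (by intro z; rw [A3]; simp only [Bool.not_true, Bool.not_false, or_comm, or_left_comm] <;>
      simp only [or_assoc])
    (by simp) (by simp) (by simp [n35]) (by simp) (by simp) (by simp [n24])
  have kB3 := LN.key _ φ hφ (false, 3) (false, 4) (false, 2) (true, 4) (false, 5) (true, 3)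
    (by intro z; rw [A3]; simp) (by intro z; rw [A4]; simp only [Bool.not_true, Bool.not_false, or_assoc, or_comm, or_left_comm] <;>
      simp only [or_assoc])
    (by simp [n24.symm]) (by simp) (by simp) (by simp [n35]) (by simp) (by simp)
  have kD := LN.key _ φ hφ (true, 3) (false, 4) (true, 2) (true, 4) (false, 3) (false, 5)
    (by intro z; rw [A3]; simp only [Bool.not_true, Bool.not_false, or_assoc, or_comm, or_left_comm] <;>
      simp only [or_assoc]) (by intro z; rw [A4]; simp only [Bool.not_true, Bool.not_false, or_comm, or_left_comm] <;>
      simp only [or_assoc])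
    (by simp) (by simp) (by simp [n24]) (by simp) (by simp) (by simp [n35])
  have kB2 := LN.key _ φ hφ (false, 2) (false, 3) (false, 1) (true, 2) (false, 4) (true, 4)
    (by intro z; rw [A2]; simp) (by intro z; rw [A3]; simp only [Bool.not_true, Bool.not_false, or_assoc, or_comm, or_left_comm] <;>
      simp only [or_assoc])
    (by simp [n13.symm]) (by simp) (by simp) (by simp [n24]) (by simp) (by simp)
  have kC2 := LN.key _ φ hφ (true, 2) (false, 2) (true, 1) (true, 3) (false, 1) (false, 3)
    (by intro z; rw [A2]; simp only [Bool.not_true, Bool.not_false, or_assoc, or_comm, or_left_comm] <;>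
      simp only [or_assoc]) (by intro z; rw [A2]; simp only [Bool.not_true, Bool.not_false, or_comm, or_left_comm] <;>
      simp only [or_assoc])
    (by simp) (by simp) (by simp [n13]) (by simp) (by simp) (by simp [n13])
  have kA2 := LN.key _ φ hφ (true, 2) (true, 3) (true, 1) (false, 2) (true, 4) (false, 4)
    (by intro z; rw [A2]; simp) (by intro z; rw [A3]; simp only [Bool.not_true, Bool.not_false, or_assoc, or_comm, or_left_comm] <;>
      simp only [or_assoc])
    (by simp [n13.symm]) (by simp) (by simp) (by simp [n24]) (by simp) (by simp)
  have sw : ∀ x y : LN.V n, φ s(x, y) = φ s(y, x) := fun x y => by rw [Sym2.eq_swap]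
  have big : ∀ x y : LN.V n, (LN.G n).Adj x y → (s(x, y) = s((true, 0), (true, 1)) ∨
      s(x, y) = s((true, 4), (true, 5)) ∨ s(x, y) = s((false, 4), (false, 5))) →
      6 ≤ φ s(x, y) := by
    intro x y hxy h
    have := hL s(x, y) hxy
    rw [LN.L, if_pos h, Finset.mem_Ico] at this
    exact this.1
  have small : ∀ x y : LN.V n, (LN.G n).Adj x y → ¬ (s(x, y) = s((true, 0), (true, 1)) ∨
      s(x, y) = s((true, 4), (true, 5)) ∨ s(x, y) = s((false, 4), (false, 5))) →
      φ s(x, y) < 6 := by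
    intro x y hxy h
    have := hL s(x, y) hxy
    rw [LN.L, if_neg h, Finset.mem_range] at this
    exact this
  have hp := big (true, 1) (true, 0) (by rw [A1]; simp) (by simp)
  have hq := big (true, 4) (true, 5) (by rw [A4]; simp) (by simp)
  have hr := big (false, 4) (false, 5) (by rw [A4]; simp) (by simp)
  have ha1 := small (true, 2) (true, 1) (by rw [A2]; simp)
    (by simp [n01.symm, n02.symm, n12, n12.symm, n14, n24, n13, n15, n25])
  have ha2 := small (true, 2) (true, 3) (by rw [A2]; simp)
    (by simp [n02.symm, n03.symm, n12.symm, n24, n25])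
  have ha3 := small (true, 3) (true, 4) (by rw [A3]; simp)
    (by simp [n03.symm, n13.symm, n34, n35])
  have hb0 := small (false, 1) (false, 0) (by rw [A1]; simp)
    (by simp [n14, n15])
  have hb1 := small (false, 2) (false, 1) (by rw [A2]; simp)
    (by simp [n24, n25])
  have hb2 := small (false, 2) (false, 3) (by rw [A2]; simp)
    (by simp [n24, n25])
  have hb3 := small (false, 3) (false, 4) (by rw [A3]; simp)
    (by simp [n34, n35])
  have hd := small (true, 3) (false, 4) (by rw [A3]; simp) (by simp)
  have he := small (true, 4) (false, 3) (by rw [A4]; simp) (by simp)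
  have hc2 := small (true, 2) (false, 2) (by rw [A2]; simp) (by simp)
  simp only [sw (true, 1) (true, 2),
    sw (false, 1) (false, 2),
    sw (true, 3) (true, 2),
    sw (true, 4) (true, 3),
    sw (false, 3) (false, 2),
    sw (false, 4) (false, 3),
    sw (false, 4) (true, 3),
    sw (false, 3) (true, 4),
    sw (false, 2) (true, 2)] at kC1 kA3 kE kB3 kD kB2 kC2 kA2
  obtain ⟨-, -, -, -, -, -, C1⟩ := kC1
  obtain ⟨h5, h2, h6, -, h1, -, A3'⟩ := kA3
  obtain ⟨-, -, -, h7, h3, h8, E⟩ := kE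
  obtain ⟨-, -, -, -, h4, -, B3⟩ := kB3
  obtain ⟨-, -, -, -, -, -, D⟩ := kD
  obtain ⟨h12, -, h11, -, -, -, B2⟩ := kB2
  obtain ⟨-, h9, -, -, h10, -, C2⟩ := kC2
  obtain ⟨h14, -, h13, -, -, -, A2'⟩ := kA2
  exact LN.arith _ _ _ _ _ _ _ _ _ _ _ _ _ ha2 ha3 hb1 hb2 hb3 ha1 hb0 hd he hc2 hp hq hr
    C1 A3' E B3 D B2 C2 A2' h1 h2 h3.symm h4 h5.symm h6 h7.symm h8 h9 h10 h11 h12.symm h13 h14.symm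

/-- There are infinitely many cyclically 4-edge-connected cubic graphs with list normal
chromatic index at least 7: for each `n` there is one on at least `n` vertices with a
list assignment with lists of size 6 admitting no normal edge-coloring. -/
theorem infinitely_many_cyc4ec_cubic_list_normal_ge_seven :
    ∀ n : ℕ, ∃ (V : Type) (G : SimpleGraph V), Finite V ∧ n ≤ Nat.card V ∧
      (∀ v, (G.neighborSet v).ncard = 3) ∧ CyclicallyFourEdgeConnected G ∧
      ∃ L : Sym2 V → Finset ℕ, (∀ e ∈ G.edgeSet, (L e).card = 6) ∧
        ¬ ∃ φ : Sym2 V → ℕ, IsNormalEdgeColoring G φ ∧ ∀ e ∈ G.edgeSet, φ e ∈ L e := by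
  intro n
  refine ⟨LN.V n, LN.G n, inferInstance, ?_, LN.cubic n, LN.cyc n, LN.L n, ?_, LN.nocol n⟩
  · rw [Nat.card_prod, Nat.card_zmod]
    simp
    omega
  · intro e _
    unfold LN.L
    split_ifs <;> simp
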